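/- arXiv:2011.04642 — 3 statements merged into one kernel-verified Lean document; each statement's English description precedes it below -/
import Mathlib

section
/- Double-sum estimate for non-connection probability: for all reals β > 0 and θ ∈ (0,1], and all integers K ≥ 1, A ≥ 1 and m ≥ 1 with A ≥ θ·K·(m−2), one has exp(−β·∑_{a=1}^{A} ∑_{b=1}^{A} 1/(6K + (a+b−2)/θ)²) ≤ (12/m)^{βθ²}. -/
/-- The second difference of `log` is bounded by the inverse square. -/
lemma log_second_diff_le_one_div_sq {x : ℝ} (hx : 0 < x) :
    2 * Real.log (x + 1) - Real.log x - Real.log (x + 2) ≤ 1 / x ^ 2 := by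
  have h1 : 2 * Real.log (x + 1) - Real.log x - Real.log (x + 2)
      = Real.log ((x + 1) ^ 2 / (x * (x + 2))) := by
    rw [Real.log_div (by positivity) (by positivity), Real.log_pow,
      Real.log_mul (by positivity) (by positivity)]
    push_cast
    ring
  have h2 : (x + 1) ^ 2 / (x * (x + 2)) - 1 = 1 / (x * (x + 2)) := by
    field_simp
    ring
  calc 2 * Real.log (x + 1) - Real.log x - Real.log (x + 2)
      ≤ (x + 1) ^ 2 / (x * (x + 2)) - 1 := by
        rw [h1]
        exact Real.log_le_sub_one_of_pos (by positivity)
    _ = 1 / (x * (x + 2)) := h2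
    _ ≤ 1 / x ^ 2 := by
        gcongr
        nlinarith

/-- The double sum of `1 / (c + a + b)²` dominates the corresponding double integral. -/
lemma log_le_sum_sum_one_div_sq {c : ℝ} (hc : 0 < c) (A : ℕ) :
    2 * Real.log (c + A) - Real.log c - Real.log (c + 2 * A) ≤
      ∑ a ∈ Finset.range A, ∑ b ∈ Finset.range A, 1 / (c + a + b) ^ 2 := by
  have row (x : ℝ) : ∑ b ∈ Finset.range A,
      (2 * Real.log (x + b + 1) - Real.log (x + b) - Real.log (x + b + 2)) =
      Real.log (x + 1) - Real.log x - (Real.log (x + A + 1) - Real.log (x + A)) := by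
    have h := Finset.sum_range_sub'
      (fun b : ℕ => Real.log (x + b + 1) - Real.log (x + b)) A
    simp only [Nat.cast_zero, add_zero] at h
    rw [← h]
    refine Finset.sum_congr rfl fun b _ => ?_
    push_cast
    rw [show x + ((b : ℝ) + 1) + 1 = x + b + 2 by ring, ← add_assoc]
    ring
  have col (x : ℝ) : ∑ a ∈ Finset.range A, (Real.log (x + a + 1) - Real.log (x + a)) =
      Real.log (x + A) - Real.log x := by
    have h := Finset.sum_range_sub (fun a : ℕ => Real.log (x + a)) A
    simp only [Nat.cast_zero, add_zero] at h
    rw [← h]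
    refine Finset.sum_congr rfl fun a _ => ?_
    push_cast
    rw [← add_assoc]
  calc 2 * Real.log (c + A) - Real.log c - Real.log (c + 2 * A)
      = ∑ a ∈ Finset.range A, ∑ b ∈ Finset.range A,
        (2 * Real.log (c + a + b + 1) - Real.log (c + a + b) - Real.log (c + a + b + 2)) := by
        simp only [row]
        rw [Finset.sum_sub_distrib, col]
        simp only [add_right_comm c _ (A : ℝ)]
        rw [col, show c + (A : ℝ) + A = c + 2 * A by ring]
        ring
    _ ≤ _ := by
        gcongr with a _ b _
        exact log_second_diff_le_one_div_sq (by positivity)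

/-- Double-sum estimate for the non-connection probability: for `β > 0`, `θ ∈ (0,1]` and
integers `K, A, m ≥ 1` with `A ≥ θK(m-2)`,
`exp(-β ∑_{a=1}^A ∑_{b=1}^A 1/(6K + (a+b-2)/θ)²) ≤ (12/m)^{βθ²}`. -/
theorem double_sum_estimate (β θ : ℝ) (hβ : 0 < β) (hθ0 : 0 < θ) (hθ1 : θ ≤ 1)
    (K A m : ℕ) (hK : 1 ≤ K) (hA : 1 ≤ A) (hm : 1 ≤ m)
    (hAm : θ * (K : ℝ) * ((m : ℝ) - 2) ≤ (A : ℝ)) :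
    Real.exp (-β * ∑ a ∈ Finset.Icc 1 A, ∑ b ∈ Finset.Icc 1 A,
        (1 : ℝ) / (6 * (K : ℝ) + ((a : ℝ) + (b : ℝ) - 2) / θ) ^ 2) ≤
      (12 / (m : ℝ)) ^ (β * θ ^ 2) := by
  have hK' : (0 : ℝ) < K := by exact_mod_cast hK
  have hm' : (0 : ℝ) < m := by exact_mod_cast hm
  set c : ℝ := 6 * K * θ with hc_def
  have hc : 0 < c := by positivity
  have hsum : ∑ a ∈ Finset.Icc 1 A, ∑ b ∈ Finset.Icc 1 A,
        (1 : ℝ) / (6 * (K : ℝ) + ((a : ℝ) + (b : ℝ) - 2) / θ) ^ 2 =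
      θ ^ 2 * ∑ a ∈ Finset.range A, ∑ b ∈ Finset.range A, 1 / (c + a + b) ^ 2 := by
    have shift (f : ℕ → ℝ) : ∑ a ∈ Finset.Icc 1 A, f a = ∑ a ∈ Finset.range A, f (a + 1) := by
      rw [Finset.range_eq_Ico, Finset.sum_Ico_add' f 0 A 1]
      rfl
    simp only [shift, Finset.mul_sum]
    refine Finset.sum_congr rfl fun a _ => Finset.sum_congr rfl fun b _ => ?_
    have : 6 * (K : ℝ) + (((a + 1 : ℕ) : ℝ) + ((b + 1 : ℕ) : ℝ) - 2) / θ = (c + a + b) / θ := by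
      rw [hc_def]
      field_simp
      push_cast
      ring
    rw [this, div_pow, one_div_div, mul_one_div]
  clear_value c
  have hlog : Real.log (m / 12) ≤
      ∑ a ∈ Finset.range A, ∑ b ∈ Finset.range A, 1 / (c + a + b) ^ 2 := by
    refine le_trans ?_ (log_le_sum_sum_one_div_sq hc A)
    have hA0 : (0 : ℝ) ≤ A := A.cast_nonneg
    have : 2 * Real.log (c + A) - Real.log c - Real.log (c + 2 * A) =
        Real.log ((c + A) ^ 2 / (c * (c + 2 * A))) := by
      rw [Real.log_div (by positivity) (by positivity), Real.log_pow,
        Real.log_mul (by positivity) (by positivity)]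
      push_cast
      ring
    rw [this]
    apply Real.log_le_log (by positivity)
    rw [div_le_div_iff₀ (by norm_num) (by positivity)]
    have hcm : c * m ≤ 6 * A + 2 * c := by
      rw [hc_def]
      linarith
    nlinarith [mul_le_mul_of_nonneg_right hcm (by positivity : 0 ≤ c + 2 * A)]
  rw [hsum, Real.rpow_def_of_pos (by positivity), Real.exp_le_exp,
    ← inv_div, Real.log_inv]
  have := mul_le_mul_of_nonneg_left hlog (by positivity : 0 ≤ β * θ ^ 2)
  linarith
end

section
/- FK closed-edge weight bound for q ≥ 1: for every real q ≥ 1 and every real u ≥ 0, one has q·e^{−u} / (1 − e^{−u} + q·e^{−u}) ≤ e^{−u/(2q)}. -/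
/-- FK closed-edge weight bound for `q ≥ 1`: for every `u ≥ 0`,
`q e^{-u} / (1 - e^{-u} + q e^{-u}) ≤ e^{-u/(2q)}`. -/
theorem fk_closed_edge_weight_bound (q u : ℝ) (hq : 1 ≤ q) (hu : 0 ≤ u) :
    q * Real.exp (-u) / (1 - Real.exp (-u) + q * Real.exp (-u)) ≤
      Real.exp (-u / (2 * q)) := by
  have hq0 : 0 < q := by linarith
  have ha := Real.exp_pos (-u)
  have hb := Real.exp_pos (-u / (2 * q))
  have ha1 : Real.exp (-u) ≤ 1 := Real.exp_le_one_iff.mpr (by linarith)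
  have hau : Real.exp (-u) * Real.exp u = 1 := by
    rw [← Real.exp_add]; simp
  have hbt : Real.exp (-u / (2 * q)) * Real.exp (u / (2 * q)) = 1 := by
    rw [← Real.exp_add, ← add_div]; simp
  have hbernoulli : 1 + q * (Real.exp (u / (2 * q)) - 1) ≤ Real.exp u := by
    have ht := Real.exp_pos (u / (2 * q))
    have h := one_add_mul_self_le_rpow_one_add
      (s := Real.exp (u / (2 * q)) - 1) (by linarith) hq
    rw [add_sub_cancel, ← Real.exp_mul] at h
    refine h.trans (Real.exp_le_exp.mpr ?_)
    have : u / (2 * q) * q = u / 2 := by field_simp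
    linarith
  rw [div_le_iff₀ (by nlinarith [mul_pos hq0 ha])]
  have h := mul_le_mul_of_nonneg_left hbernoulli (mul_pos ha hb).le
  linear_combination h + Real.exp (-u / (2 * q)) * hau - q * Real.exp (-u) * hbt
end

section
/- Deterministic merging of good blocks: let E be any set of unordered pairs of integers (open edges), let θ ∈ (3/4, 1] be real and let K ≥ 1, C ≥ 2 be integers. For S ⊆ ℤ, call a cluster in S a connected component of the graph with vertex set S and the edges of E with both endpoints in S, and set B_K^j = [K(j−1), K(j+1)) ∩ ℤ. If for every integer j with −C+1 ≤ j ≤ C−1 the block B_K^j contains a cluster of cardinality at least 2θK, then B_{CK} = [−CK, CK) ∩ ℤ contains a cluster of cardinality at least 2θ(C−1)K. -/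
/-- The cluster of `x` inside `S` for the graph on `ℤ` with adjacency `adj`: the connected
component of `x` in the graph with vertex set `S` and the edges of `adj` with both endpoints
in `S`. -/
def clusterIn (adj : ℤ → ℤ → Prop) (S : Set ℤ) (x : ℤ) : Set ℤ :=
  {y | Relation.ReflTransGen (fun u v => u ∈ S ∧ v ∈ S ∧ adj u v) x y}

/-- The `K`-block `B_K^j = [K(j-1), K(j+1)) ∩ ℤ`. -/
def blockSet (K : ℕ) (j : ℤ) : Set ℤ := Set.Ico ((K : ℤ) * (j - 1)) ((K : ℤ) * (j + 1))

theorem clusterIn_subset {adj : ℤ → ℤ → Prop} {S : Set ℤ} {x : ℤ} (hx : x ∈ S) :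
    clusterIn adj S x ⊆ S := by
  intro y hy
  induction hy with
  | refl => exact hx
  | tail _ h _ => exact h.2.1

theorem clusterIn_mono {adj : ℤ → ℤ → Prop} {S T : Set ℤ} (h : S ⊆ T) (x : ℤ) :
    clusterIn adj S x ⊆ clusterIn adj T x :=
  fun _ hy => Relation.ReflTransGen.mono (fun _ _ huv => ⟨h huv.1, h huv.2.1, huv.2.2⟩) _ _ hy

theorem mem_clusterIn_symm {adj : ℤ → ℤ → Prop} (hadj : ∀ ⦃u v⦄, adj u v → adj v u)
    {S : Set ℤ} {x y : ℤ} (h : y ∈ clusterIn adj S x) : x ∈ clusterIn adj S y := by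
  induction h with
  | refl => exact Relation.ReflTransGen.refl
  | tail _ huv ih => exact Relation.ReflTransGen.head ⟨huv.2.1, huv.1, hadj huv.2.2⟩ ih

theorem mem_clusterIn_trans {adj : ℤ → ℤ → Prop} {S : Set ℤ} {x y z : ℤ}
    (hy : y ∈ clusterIn adj S x) (hz : z ∈ clusterIn adj S y) : z ∈ clusterIn adj S x :=
  Relation.ReflTransGen.trans hy hz

/-- Two sets of density greater than `3/4` in consecutive blocks intersect. -/
theorem inter_nonempty_of_dense {A B : Set ℤ} {θ : ℝ} (hθ : 3 / 4 < θ) {K : ℕ} (hK : 1 ≤ K)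
    {j : ℤ} (hA : A ⊆ blockSet K j) (hB : B ⊆ blockSet K (j + 1))
    (hAc : 2 * θ * (K : ℝ) ≤ (A.ncard : ℝ)) (hBc : 2 * θ * (K : ℝ) ≤ (B.ncard : ℝ)) :
    (A ∩ B).Nonempty := by
  by_contra hne
  rw [Set.not_nonempty_iff_eq_empty] at hne
  have hfA : A.Finite := (Set.finite_Ico _ _).subset hA
  have hfB : B.Finite := (Set.finite_Ico _ _).subset hB
  have hunion := Set.ncard_union_eq (Set.disjoint_iff_inter_eq_empty.mpr hne) hfA hfB
  have hsub : A ∪ B ⊆ Set.Ico ((K : ℤ) * (j - 1)) ((K : ℤ) * (j - 1) + 3 * K) := by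
    rintro y (hy | hy)
    · have := hA hy
      simp only [blockSet, Set.mem_Ico] at this ⊢
      constructor <;> linarith
    · have := hB hy
      simp only [blockSet, Set.mem_Ico] at this ⊢
      constructor <;> linarith
  have hle := Set.ncard_le_ncard hsub (Set.finite_Ico _ _)
  have hcard : (Set.Ico ((K : ℤ) * (j - 1)) ((K : ℤ) * (j - 1) + 3 * K)).ncard = 3 * K := by
    rw [← Finset.coe_Ico, Set.ncard_coe_finset, Int.card_Ico]
    omega
  rw [hcard, hunion] at hle
  have hle' : (A.ncard : ℝ) + B.ncard ≤ 3 * K := by exact_mod_cast hle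
  have hK' : (1 : ℝ) ≤ K := by exact_mod_cast hK
  nlinarith

theorem blockSet_subset_blockSet_mul {K C : ℕ} {j : ℤ} (h1 : -(C : ℤ) + 1 ≤ j)
    (h2 : j ≤ (C : ℤ) - 1) : blockSet K j ⊆ blockSet (C * K) 0 := by
  have hK : (0 : ℤ) ≤ K := Int.natCast_nonneg K
  apply Set.Ico_subset_Ico <;> push_cast <;> nlinarith

/-- Deterministic merging of good blocks: for a symmetric set of open edges, `θ ∈ (3/4, 1]`,
`K ≥ 1` and `C ≥ 2`, if every block `B_K^j` with `-C+1 ≤ j ≤ C-1` contains a cluster of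
cardinality at least `2θK`, then `B_{CK} = [-CK, CK) ∩ ℤ` contains a cluster of cardinality
at least `2θ(C-1)K`. -/
theorem merging_good_blocks (adj : ℤ → ℤ → Prop) (hadj : Symmetric adj)
    (θ : ℝ) (hθ1 : 3 / 4 < θ) (hθ2 : θ ≤ 1) (K C : ℕ) (hK : 1 ≤ K) (hC : 2 ≤ C)
    (hgood : ∀ j : ℤ, -(C : ℤ) + 1 ≤ j → j ≤ (C : ℤ) - 1 →
      ∃ x ∈ blockSet K j, 2 * θ * (K : ℝ) ≤ ((clusterIn adj (blockSet K j) x).ncard : ℝ)) :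
    ∃ x ∈ blockSet (C * K) 0,
      2 * θ * ((C : ℝ) - 1) * (K : ℝ) ≤ ((clusterIn adj (blockSet (C * K) 0) x).ncard : ℝ) := by
  choose! x hx hcard using hgood
  set T := blockSet (C * K) 0
  set a : ℤ := -(C : ℤ) + 1 with ha
  have hsub : ∀ j : ℤ, a ≤ j → j ≤ (C : ℤ) - 1 → blockSet K j ⊆ T :=
    fun j h1 h2 => blockSet_subset_blockSet_mul h1 h2
  have hconn : ∀ n : ℕ, a + n ≤ (C : ℤ) - 1 → x (a + n) ∈ clusterIn adj T (x a) := by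
    intro n
    induction n with
    | zero =>
      intro _
      rw [Nat.cast_zero, add_zero]
      exact Relation.ReflTransGen.refl
    | succ n ih =>
      intro hn
      push_cast at hn ⊢
      rw [← add_assoc] at hn ⊢
      have h1 : a ≤ a + n := by omega
      have h2 : a + n ≤ (C : ℤ) - 1 := by omega
      have h3 : a ≤ a + n + 1 := by omega
      obtain ⟨z, hz, hz'⟩ := inter_nonempty_of_dense hθ1 hK
        (clusterIn_subset (hx _ h1 h2)) (clusterIn_subset (hx _ h3 hn))
        (hcard _ h1 h2) (hcard _ h3 hn)
      exact mem_clusterIn_trans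
        (mem_clusterIn_trans (ih h2) (clusterIn_mono (hsub _ h1 h2) _ hz))
        (mem_clusterIn_symm hadj (clusterIn_mono (hsub _ h3 hn) _ hz'))
  have hxa : x a ∈ T := hsub a le_rfl (by omega) (hx a le_rfl (by omega))
  set G := clusterIn adj T (x a)
  have hcount : ∀ n : ℕ, n ≤ C → 2 * θ * (K : ℝ) * n ≤
      ((G ∩ Set.Iio ((K : ℤ) * (a - 1 + 2 * n))).ncard : ℝ) := by
    have hGfin : G.Finite := (Set.finite_Ico _ _).subset (clusterIn_subset hxa)
    intro n
    induction n with
    | zero => simp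
    | succ n ih =>
      intro hn
      have h1 : a ≤ a + (2 * n : ℕ) := by omega
      have h2 : a + (2 * n : ℕ) ≤ (C : ℤ) - 1 := by omega
      set D := clusterIn adj (blockSet K (a + (2 * n : ℕ))) (x (a + (2 * n : ℕ)))
      have hDsub : D ⊆ blockSet K (a + (2 * n : ℕ)) := clusterIn_subset (hx _ h1 h2)
      have hDG : D ⊆ G := fun y hy =>
        mem_clusterIn_trans (hconn _ h2) (clusterIn_mono (hsub _ h1 h2) _ hy)
      have hdisj : Disjoint (G ∩ Set.Iio ((K : ℤ) * (a - 1 + 2 * n))) D := by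
        rw [Set.disjoint_left]
        rintro y ⟨_, hy⟩ hyD
        have h := (hDsub hyD).1
        push_cast at h
        rw [Set.mem_Iio] at hy
        linarith
      have hle : ((G ∩ Set.Iio ((K : ℤ) * (a - 1 + 2 * n))) ∪ D) ⊆
          G ∩ Set.Iio ((K : ℤ) * (a - 1 + 2 * (n + 1 : ℕ))) := by
        rintro y (⟨hyG, hy⟩ | hy)
        · refine ⟨hyG, ?_⟩
          rw [Set.mem_Iio] at hy ⊢
          push_cast
          linarith
        · refine ⟨hDG hy, ?_⟩
          have h := (hDsub hy).2
          rw [Set.mem_Iio]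
          push_cast at h ⊢
          linarith
      have hncard := Set.ncard_le_ncard hle (hGfin.inter_of_left _)
      rw [Set.ncard_union_eq hdisj (hGfin.inter_of_left _) (hGfin.subset hDG)] at hncard
      calc 2 * θ * (K : ℝ) * (n + 1 : ℕ) = 2 * θ * K * n + 2 * θ * K := by push_cast; ring
        _ ≤ ((G ∩ Set.Iio ((K : ℤ) * (a - 1 + 2 * n))).ncard : ℝ) + D.ncard :=
          add_le_add (ih (by omega)) (hcard _ h1 h2)
        _ ≤ _ := by exact_mod_cast hncard
  refine ⟨x a, hxa, ?_⟩
  have hGle := Set.ncard_le_ncard (Set.inter_subset_left (s := G)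
    (t := Set.Iio ((K : ℤ) * (a - 1 + 2 * C)))) ((Set.finite_Ico _ _).subset (clusterIn_subset hxa))
  have hθK : 0 ≤ 2 * θ * (K : ℝ) := by positivity
  calc 2 * θ * ((C : ℝ) - 1) * K ≤ 2 * θ * K * C := by linarith
    _ ≤ _ := hcount C le_rfl
    _ ≤ _ := by exact_mod_cast hGle
end
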